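/- Let α be a 2-form on ℝ⁷ with ⋆(α∧ω) = α. Then for every k: α_{ij}ω_{ijk} = 0 (summing over i,j), and for all i,j,k: α_{ip}ω_{pjk} + α_{jp}ω_{pki} + α_{kp}ω_{pij} = 0 (summing over p). -/

import Mathlib

open scoped BigOperators

/-- The generalized Kronecker/Levi-Civita epsilon symbol on `Fin 7`. -/
noncomputable def eps (v : Fin 7 → Fin 7) : ℝ :=
  if h : Function.Bijective v then ((Equiv.Perm.sign (Equiv.ofBijective v h) : ℤ) : ℝ) else 0

/-- The basis monomial form `e_{I 0} ∧ ⋯ ∧ e_{I (p-1)}`, given by its components. -/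
noncomputable def mono {p : ℕ} (I : Fin p → Fin 7) : (Fin p → Fin 7) → ℝ :=
  fun v => Matrix.det (Matrix.of fun a b => if I a = v b then (1 : ℝ) else 0)

/-- A (componentwise) `p`-form: totally antisymmetric in its indices. -/
def IsForm {p : ℕ} (c : (Fin p → Fin 7) → ℝ) : Prop :=
  (∀ v : Fin p → Fin 7, ¬ Function.Injective v → c v = 0) ∧
  (∀ (v : Fin p → Fin 7) (σ : Equiv.Perm (Fin p)),
    c (v ∘ σ) = ((Equiv.Perm.sign σ : ℤ) : ℝ) * c v)

/-- Wedge product of forms, in components. -/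
noncomputable def wedge {p q : ℕ} (a : (Fin p → Fin 7) → ℝ) (b : (Fin q → Fin 7) → ℝ) :
    (Fin (p + q) → Fin 7) → ℝ := fun v =>
  (1 / ((Nat.factorial p : ℝ) * (Nat.factorial q : ℝ))) *
    ∑ σ : Equiv.Perm (Fin (p + q)),
      ((Equiv.Perm.sign σ : ℤ) : ℝ) *
        a (fun i => v (σ (Fin.castAdd q i))) * b (fun j => v (σ (Fin.natAdd p j)))

/-- The Hodge star operator (standard metric and orientation on ℝ⁷), in components. -/
noncomputable def hstar {p q : ℕ} (h : p + q = 7) (a : (Fin p → Fin 7) → ℝ) :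
    (Fin q → Fin 7) → ℝ := fun w =>
  (1 / (Nat.factorial p : ℝ)) *
    ∑ v : Fin p → Fin 7, a v * eps (fun i => Fin.append v w (Fin.cast h.symm i))

/-- The fundamental 3-form ω = e₁₂₄+e₂₃₅+e₃₄₆+e₄₅₇+e₅₆₁+e₆₇₂+e₇₁₃ (indices shifted to 0,…,6). -/
noncomputable def ω : (Fin 3 → Fin 7) → ℝ :=
  mono ![0, 1, 3] + mono ![1, 2, 4] + mono ![2, 3, 5] + mono ![3, 4, 6] +
    mono ![4, 5, 0] + mono ![5, 6, 1] + mono ![6, 0, 2]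

/-- The 4-form Φ = −e₃₅₆₇−e₄₆₇₁−e₅₇₁₂−e₆₁₂₃−e₇₂₃₄−e₁₃₄₅−e₂₄₅₆ (indices shifted to 0,…,6). -/
noncomputable def Φ : (Fin 4 → Fin 7) → ℝ :=
  -mono ![2, 4, 5, 6] - mono ![3, 5, 6, 0] - mono ![4, 6, 0, 1] - mono ![5, 0, 1, 2] -
    mono ![6, 1, 2, 3] - mono ![0, 2, 3, 4] - mono ![1, 3, 4, 5]

/-- Components ω_{ijk}. -/
noncomputable def ω3 (i j k : Fin 7) : ℝ := ω ![i, j, k]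

/-- Components ω_{ijkl} = Φ(e_i,e_j,e_k,e_l). -/
noncomputable def ω4 (i j k l : Fin 7) : ℝ := Φ ![i, j, k, l]

/-- Kronecker delta. -/
def δ (i j : Fin 7) : ℝ := if i = j then 1 else 0

/-- Components of a 2-form. -/
def c2 (a : (Fin 2 → Fin 7) → ℝ) (i j : Fin 7) : ℝ := a ![i, j]

/-- The operator α ↦ ⋆(α ∧ ω) on 2-forms. -/
noncomputable def Lω (a : (Fin 2 → Fin 7) → ℝ) : (Fin 2 → Fin 7) → ℝ :=
  hstar (p := 5) (q := 2) rfl (wedge a ω)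

/-- The components of `ω`: the lines `{m, m+1, m+3}` are the triples with consecutive differences
proportional to `(1, 3)` by a quadratic residue modulo 7. -/
def omegaInt (i j k : Fin 7) : ℤ :=
  if k - i = 3 * (j - i) ∧ (j - i = 1 ∨ j - i = 2 ∨ j - i = 4) then 1
  else if j - i = 3 * (k - i) ∧ (k - i = 1 ∨ k - i = 2 ∨ k - i = 4) then -1
  else 0

/-- The epsilon symbol as a product over pairs of indices. -/
def epsInt (v : Fin 7 → Fin 7) : ℤ :=
  ∏ i, ∏ j ∈ Finset.Ioi i, if v i < v j then 1 else if v i = v j then 0 else -1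

/-- The components of the 4-form dual to `ω`. -/
def dualInt (i j k l : Fin 7) : ℤ :=
  ∑ m, omegaInt i j m * omegaInt m k l
    - (if i = k ∧ j = l then 1 else 0) + (if i = l ∧ j = k then 1 else 0)

theorem eps_eq_epsInt (v : Fin 7 → Fin 7) : eps v = epsInt v := by
  unfold eps epsInt
  split_ifs with h
  · rw [Equiv.Perm.sign_eq_prod_prod_Ioi]
    push_cast
    refine Finset.prod_congr rfl fun i _ => Finset.prod_congr rfl fun j hj => ?_
    have hij : v i ≠ v j := h.1.ne (Finset.mem_Ioi.mp hj).ne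
    by_cases hlt : v i < v j <;> simp [hij, hlt]
  · obtain ⟨i, j, hij, hlt⟩ : ∃ i j, v i = v j ∧ i < j := by
      have hinj : ¬ Function.Injective v := fun hi => h (Finite.injective_iff_bijective.mp hi)
      simp only [Function.Injective, not_forall] at hinj
      obtain ⟨i, j, hv, hne⟩ := hinj
      rcases lt_or_gt_of_ne hne with hl | hl
      exacts [⟨i, j, hv, hl⟩, ⟨j, i, hv.symm, hl⟩]
    symm
    rw [Int.cast_eq_zero]
    refine Finset.prod_eq_zero (Finset.mem_univ i) (Finset.prod_eq_zero (Finset.mem_Ioi.mpr hlt) ?_)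
    simp [hij]

theorem eps_comp_perm (v : Fin 7 → Fin 7) (σ : Equiv.Perm (Fin 7)) :
    eps (v ∘ σ) = ((Equiv.Perm.sign σ : ℤ) : ℝ) * eps v := by
  unfold eps
  by_cases h : Function.Bijective v
  · have h' : Function.Bijective (v ∘ σ) := h.comp σ.bijective
    have hof : Equiv.ofBijective (v ∘ σ) h' = Equiv.ofBijective v h * σ := by
      ext; rfl
    rw [dif_pos h, dif_pos h', hof, Equiv.Perm.sign_mul]
    push_cast
    ring
  · have h' : ¬ Function.Bijective (v ∘ σ) := fun hb => h (by
      simpa [Function.comp_assoc] using hb.comp σ.symm.bijective)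
    rw [dif_neg h, dif_neg h', mul_zero]

theorem mono_eq_sum {p : ℕ} (I v : Fin p → Fin 7) :
    mono I v = ∑ σ : Equiv.Perm (Fin p),
      ((Equiv.Perm.sign σ : ℤ) : ℝ) * if v = I ∘ σ then 1 else 0 := by
  unfold mono
  rw [Matrix.det_apply']
  refine Finset.sum_congr rfl fun σ _ => ?_
  simp [Finset.prod_ite_zero, funext_iff, eq_comm]

/-- Contracting a basis monomial with an alternating function evaluates the latter. -/
theorem sum_mono_mul {p : ℕ} (I : Fin p → Fin 7) (f : (Fin p → Fin 7) → ℝ)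
    (hf : ∀ v (σ : Equiv.Perm (Fin p)), f (v ∘ σ) = ((Equiv.Perm.sign σ : ℤ) : ℝ) * f v) :
    ∑ v, mono I v * f v = (p.factorial : ℝ) * f I := by
  simp_rw [mono_eq_sum, Finset.sum_mul]
  rw [Finset.sum_comm]
  have hσ (σ : Equiv.Perm (Fin p)) :
      ∑ v, ((Equiv.Perm.sign σ : ℤ) : ℝ) * (if v = I ∘ σ then 1 else 0) * f v = f I := by
    have hs : ((Equiv.Perm.sign σ : ℤ) : ℝ) * ((Equiv.Perm.sign σ : ℤ) : ℝ) = 1 := by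
      rcases Int.units_eq_one_or (Equiv.Perm.sign σ) with h | h <;> simp [h]
    simp [hf, ← mul_assoc, hs]
  simp_rw [hσ]
  simp [Fintype.card_perm]

theorem omega_eq_sum : ω = ∑ m : Fin 7, mono ![m, m + 1, m + 3] := by
  rw [Fin.sum_univ_seven]
  rfl

theorem omega3_eq_omegaInt (i j k : Fin 7) : ω3 i j k = omegaInt i j k := by
  have h : ∀ i j k : Fin 7, ∑ m : Fin 7, Matrix.det (Matrix.of fun a b =>
      if ![m, m + 1, m + 3] a = ![i, j, k] b then (1 : ℤ) else 0) = omegaInt i j k := by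
    simp only [Matrix.det_fin_three]
    decide +kernel
  rw [← h, ω3, omega_eq_sum, Finset.sum_apply, Int.cast_sum]
  refine Finset.sum_congr rfl fun m _ => ?_
  rw [Int.cast_det, mono]
  congr 1
  ext a b
  simp

theorem eps_append_comp_perm {p q : ℕ} (h : p + q = 7) (v : Fin p → Fin 7) (w : Fin q → Fin 7)
    (σ : Equiv.Perm (Fin p)) :
    eps (fun i => Fin.append (v ∘ σ) w (Fin.cast h.symm i)) =
      ((Equiv.Perm.sign σ : ℤ) : ℝ) * eps (fun i => Fin.append v w (Fin.cast h.symm i)) := by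
  let e : Fin p ⊕ Fin q ≃ Fin 7 := finSumFinEquiv.trans (finCongr h)
  have hsign : Equiv.Perm.sign (e.permCongr (Equiv.Perm.sumCongr σ 1)) = Equiv.Perm.sign σ := by
    rw [Equiv.Perm.sign_permCongr, Equiv.Perm.sign_sumCongr, map_one, mul_one]
  rw [← hsign, ← eps_comp_perm]
  congr 1
  funext i
  obtain ⟨s, rfl⟩ := e.surjective i
  rcases s with s | s <;> simp [e]

theorem append_comp_perm_right {p q : ℕ} (u : Fin p → Fin 7) (t : Fin q → Fin 7)
    (σ : Equiv.Perm (Fin q)) :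
    Fin.append u (t ∘ σ) =
      Fin.append u t ∘ finSumFinEquiv.permCongr (Equiv.Perm.sumCongr 1 σ) := by
  funext i
  obtain ⟨s, rfl⟩ := finSumFinEquiv.surjective i
  rcases s with s | s <;> simp

theorem hstar_wedge_eq_sum {p q r : ℕ} (h : p + q + r = 7) (a : (Fin p → Fin 7) → ℝ)
    (b : (Fin q → Fin 7) → ℝ) (w : Fin r → Fin 7) :
    hstar h (wedge a b) w = 1 / ((p.factorial : ℝ) * q.factorial) *
      ∑ u, a u * ∑ t, b t * eps (fun i => Fin.append (Fin.append u t) w (Fin.cast h.symm i)) := by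
  let F : (Fin (p + q) → Fin 7) → ℝ := fun v =>
    a (fun i => v (Fin.castAdd q i)) * b (fun j => v (Fin.natAdd p j)) *
      eps (fun i => Fin.append v w (Fin.cast h.symm i))
  have hterm (σ : Equiv.Perm (Fin (p + q))) (v : Fin (p + q) → Fin 7) :
      ((Equiv.Perm.sign σ : ℤ) : ℝ) *
        a (fun i => v (σ (Fin.castAdd q i))) * b (fun j => v (σ (Fin.natAdd p j))) *
        eps (fun i => Fin.append v w (Fin.cast h.symm i)) = F (v ∘ σ) := by
    simp only [F, Function.comp_apply]
    rw [eps_append_comp_perm h]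
    ring
  have hperm (σ : Equiv.Perm (Fin (p + q))) : ∑ v, F (v ∘ σ) = ∑ v, F v :=
    (Equiv.arrowCongr σ.symm (Equiv.refl (Fin 7))).sum_comp F
  have hsplit : ∑ v, F v = ∑ u, a u * ∑ t, b t *
      eps (fun i => Fin.append (Fin.append u t) w (Fin.cast h.symm i)) := by
    rw [← (Fin.appendEquiv p q).sum_comp F, Fintype.sum_prod_type]
    simp [F, Fin.appendEquiv, Finset.mul_sum, mul_assoc]
  have hfac : ((p + q).factorial : ℝ) ≠ 0 := by positivity
  rw [← hsplit]
  calc hstar h (wedge a b) w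
      = 1 / ((p + q).factorial : ℝ) * (1 / ((p.factorial : ℝ) * q.factorial) *
          ∑ σ : Equiv.Perm (Fin (p + q)), ∑ v, F (v ∘ σ)) := by
        rw [Finset.sum_comm, hstar]
        congr 1
        simp_rw [← hterm, wedge, ← Finset.sum_mul, mul_assoc, ← Finset.mul_sum]
    _ = 1 / ((p.factorial : ℝ) * q.factorial) * ∑ v, F v := by
        simp_rw [hperm]
        rw [Finset.sum_const, Finset.card_univ, Fintype.card_perm, Fintype.card_fin, nsmul_eq_mul]
        field_simp

theorem sum_fin_two_arrow (f : (Fin 2 → Fin 7) → ℝ) : ∑ u, f u = ∑ i, ∑ j, f ![i, j] := by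
  rw [← (finTwoArrowEquiv (Fin 7)).symm.sum_comp f, Fintype.sum_prod_type]
  rfl

theorem Lω_apply (a : (Fin 2 → Fin 7) → ℝ) (k l : Fin 7) :
    Lω a ![k, l] = 1 / 2 * ∑ i, ∑ j, c2 a i j *
      ∑ m, (epsInt ![i, j, m, m + 1, m + 3, k, l] : ℝ) := by
  have hvec (i j m : Fin 7) : (fun s : Fin 7 => Fin.append
      (Fin.append ![i, j] ![m, m + 1, m + 3]) ![k, l] (Fin.cast rfl s)) =
      ![i, j, m, m + 1, m + 3, k, l] := by
    funext s
    fin_cases s <;> rfl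
  have hinner (i j : Fin 7) : ∑ t, ω t *
      eps (fun s => Fin.append (Fin.append ![i, j] t) ![k, l] (Fin.cast rfl s)) =
      6 * ∑ m, (epsInt ![i, j, m, m + 1, m + 3, k, l] : ℝ) := by
    simp_rw [omega_eq_sum, Finset.sum_apply, Finset.sum_mul]
    rw [Finset.sum_comm, Finset.mul_sum]
    refine Finset.sum_congr rfl fun m _ => ?_
    rw [sum_mono_mul ![m, m + 1, m + 3] (fun t => eps (fun s =>
      Fin.append (Fin.append ![i, j] t) ![k, l] (Fin.cast rfl s))), hvec, eps_eq_epsInt]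
    · norm_num [Nat.factorial]
    · intro t σ
      rw [append_comp_perm_right, eps_append_comp_perm (p := 5) (q := 2) rfl]
      simp
  have hL := hstar_wedge_eq_sum (p := 2) (q := 3) (r := 2) rfl a ω ![k, l]
  rw [sum_fin_two_arrow] at hL
  refine hL.trans ?_
  simp_rw [hinner, Finset.mul_sum]
  refine Finset.sum_congr rfl fun i _ => Finset.sum_congr rfl fun j _ =>
    Finset.sum_congr rfl fun m _ => ?_
  norm_num [Nat.factorial, c2]
  ring

theorem eps_sub_right (v : Fin 7 → Fin 7) (t : Fin 7) : eps (fun s => v s - t) = eps v := by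
  have hsign : Equiv.Perm.sign (Equiv.subRight t) = 1 := by
    revert t
    decide +kernel
  unfold eps
  by_cases h : Function.Bijective v
  · have h' : Function.Bijective (fun s => v s - t) := (Equiv.subRight t).bijective.comp h
    have hof : Equiv.ofBijective _ h' = Equiv.subRight t * Equiv.ofBijective v h := by
      ext; rfl
    rw [dif_pos h, dif_pos h', hof, Equiv.Perm.sign_mul, hsign, one_mul]
  · have h' : ¬ Function.Bijective (fun s => v s - t) := fun hb =>
      h (((Equiv.subRight t).comp_bijective v).mp hb)
    rw [dif_neg h, dif_neg h']

theorem omegaInt_sub_right (i j k t : Fin 7) :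
    omegaInt (i - t) (j - t) (k - t) = omegaInt i j k := by
  simp only [omegaInt, sub_sub_sub_cancel_right]

theorem dualInt_sub_right (i j k l t : Fin 7) :
    dualInt (i - t) (j - t) (k - t) (l - t) = dualInt i j k l := by
  unfold dualInt
  rw [← (Equiv.subRight t).sum_comp]
  simp only [Equiv.subRight_apply, omegaInt_sub_right, sub_left_inj]

theorem sum_epsInt (k i j : Fin 7) :
    ∑ m, epsInt ![i, j, m, m + 1, m + 3, k + 1, k + 3] =
      (if i = k + 1 ∧ j = k + 3 then 1 else 0) - (if j = k + 1 ∧ i = k + 3 then 1 else 0)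
        - omegaInt i j k := by
  have hzero : ∀ i j : Fin 7, ∑ m, epsInt ![i, j, m, m + 1, m + 3, 1, 3] =
      (if i = 1 ∧ j = 3 then 1 else 0) - (if j = 1 ∧ i = 3 then 1 else 0)
        - omegaInt i j 0 := by
    decide +kernel
  have hshift (m : Fin 7) : epsInt ![i, j, m, m + 1, m + 3, k + 1, k + 3] =
      epsInt ![i - k, j - k, m - k, m - k + 1, m - k + 3, 1, 3] := by
    have hv : ![i - k, j - k, m - k, m - k + 1, m - k + 3, 1, 3] =
        fun s => ![i, j, m, m + 1, m + 3, k + 1, k + 3] s - k := by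
      funext s
      fin_cases s <;> simp [add_sub_right_comm]
    apply Int.cast_injective (α := ℝ)
    rw [← eps_eq_epsInt, ← eps_eq_epsInt, hv, eps_sub_right]
  have hsum := hzero (i - k) (j - k)
  rw [← (Equiv.subRight k).sum_comp, ← sub_self k, omegaInt_sub_right] at hsum
  simp_rw [hshift]
  simpa [sub_eq_iff_eq_add, add_comm] using hsum

theorem dualInt_contraction (i j k p q : Fin 7) :
    ((if i = q then omegaInt p j k else 0) + (if j = q then omegaInt p k i else 0)
        + (if k = q then omegaInt p i j else 0))
      - ((if i = p then omegaInt q j k else 0) + (if j = p then omegaInt q k i else 0)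
        + (if k = p then omegaInt q i j else 0)) =
      ∑ l, dualInt i j k l * omegaInt p q l := by
  have hzero : ∀ j k p q : Fin 7,
      ((if 0 = q then omegaInt p j k else 0) + (if j = q then omegaInt p k 0 else 0)
          + (if k = q then omegaInt p 0 j else 0))
        - ((if 0 = p then omegaInt q j k else 0) + (if j = p then omegaInt q k 0 else 0)
          + (if k = p then omegaInt q 0 j else 0)) =
        ∑ l, dualInt 0 j k l * omegaInt p q l := by
    decide +kernel
  have h := hzero (j - i) (k - i) (p - i) (q - i)
  rw [← (Equiv.subRight i).sum_comp, ← sub_self i] at h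
  simpa only [Equiv.subRight_apply, omegaInt_sub_right, dualInt_sub_right, sub_left_inj] using h

/-- for α ∈ Λ²₁₄ one has α_{ij}ω_{ijk} = 0 and the cyclic identity
α_{ip}ω_{pjk} + α_{jp}ω_{pki} + α_{kp}ω_{pij} = 0. -/
theorem lambda14_contractions (a : (Fin 2 → Fin 7) → ℝ) (ha : IsForm a) (h14 : Lω a = a) :
    (∀ k : Fin 7, ∑ i : Fin 7, ∑ j : Fin 7, c2 a i j * ω3 i j k = 0) ∧
    (∀ i j k : Fin 7,
      ∑ p : Fin 7, (c2 a i p * ω3 p j k + c2 a j p * ω3 p k i + c2 a k p * ω3 p i j) = 0) := by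
  have hanti (i j : Fin 7) : c2 a j i = -c2 a i j := by
    have h := ha.2 ![i, j] (Equiv.swap 0 1)
    have hv : ![i, j] ∘ Equiv.swap (0 : Fin 2) 1 = ![j, i] := by
      funext s
      fin_cases s <;> rfl
    rw [hv] at h
    simpa [c2] using h
  have hS (k : Fin 7) : ∑ i, ∑ j, c2 a i j * (omegaInt i j k : ℝ) = 0 := by
    have h := congrFun h14 ![k + 1, k + 3]
    rw [Lω_apply] at h
    simp_rw [← Int.cast_sum, sum_epsInt] at h
    push_cast at h
    simp only [mul_sub, Finset.sum_sub_distrib, ite_and, mul_ite, mul_one, mul_zero,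
      Finset.sum_ite_eq', Finset.sum_ite_irrel, Finset.mem_univ, if_true, Finset.sum_const_zero] at h
    rw [hanti (k + 1) (k + 3)] at h
    change _ = c2 a (k + 1) (k + 3) at h
    linarith
  simp_rw [omega3_eq_omegaInt]
  refine ⟨hS, fun i j k => ?_⟩
  let C : Fin 7 → Fin 7 → ℝ := fun p q =>
    (if i = q then (omegaInt p j k : ℝ) else 0) + (if j = q then (omegaInt p k i : ℝ) else 0)
      + (if k = q then (omegaInt p i j : ℝ) else 0)
  have hC (p q : Fin 7) : C p q - C q p = ∑ l, (dualInt i j k l : ℝ) * (omegaInt p q l : ℝ) := by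
    have h := congrArg (Int.cast : ℤ → ℝ) (dualInt_contraction i j k p q)
    push_cast at h
    exact h
  have hsum : ∑ p, (c2 a i p * (omegaInt p j k : ℝ) + c2 a j p * (omegaInt p k i : ℝ)
      + c2 a k p * (omegaInt p i j : ℝ)) = ∑ p, ∑ q, c2 a q p * C p q := by
    simp [C, mul_add, Finset.sum_add_distrib]
  have hswap : ∑ p, ∑ q, c2 a q p * C p q = -∑ p, ∑ q, c2 a q p * C q p := by
    rw [Finset.sum_comm, ← Finset.sum_neg_distrib]
    refine Finset.sum_congr rfl fun p _ => ?_
    rw [← Finset.sum_neg_distrib]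
    exact Finset.sum_congr rfl fun q _ => by rw [hanti q p]; ring
  have hdual : ∑ p, ∑ q, c2 a q p * (C p q - C q p) = 0 := by
    calc ∑ p, ∑ q, c2 a q p * (C p q - C q p)
        = -∑ l, (dualInt i j k l : ℝ) * ∑ p, ∑ q, c2 a p q * (omegaInt p q l : ℝ) := by
          simp_rw [hC, Finset.mul_sum, ← Finset.sum_neg_distrib]
          rw [Finset.sum_comm (s := .univ) (t := .univ)
            (f := fun l p => ∑ q, -((dualInt i j k l : ℝ) * (c2 a p q * (omegaInt p q l : ℝ))))]
          refine Finset.sum_congr rfl fun p _ => ?_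
          rw [Finset.sum_comm]
          refine Finset.sum_congr rfl fun l _ => Finset.sum_congr rfl fun q _ => ?_
          rw [hanti p q]
          ring
      _ = 0 := by simp [hS]
  simp only [mul_sub, Finset.sum_sub_distrib] at hdual
  rw [hsum]
  linarith
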